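/- Let E and H be real Hilbert spaces with a continuous embedding E ⊂ H; write ‖·‖ for the norm of E and |·| for the norm of H. Let Φ : E → ℝ be twice continuously Fréchet differentiable, let μ > 0 and S_μ = {u ∈ E : |u|² = μ}. Let {u_n} ⊂ S_μ, {λ_n} ⊂ ℝ, and {ζ_n} ⊂ (0, +∞) with ζ_n → 0⁺. Assume: (i) for all sufficiently large n, every subspace W ⊂ E with the property that Φ''(u_n)[φ, φ] + λ_n|φ|² < −ζ_n‖φ‖² for all φ ∈ W ∖ {0} satisfies dim W ≤ 2; (ii) there exist λ ∈ ℝ, a subspace Y ⊂ E with dim Y ≥ 3, and a > 0 such that, for all sufficiently large n, Φ''(u_n)[φ, φ] + λ|φ|² ≤ −a‖φ‖² for all φ ∈ Y. Then λ_n > λ for all sufficiently large n. In particular, if for every λ < 0 there exist such Y and a (possibly depending on λ) satisfying (ii), then liminf_{n→∞} λ_n ≥ 0. -/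

import Mathlib

open MeasureTheory Set Filter

/-- Lemma 2.5 of the paper: a uniform lower bound for the sequence of almost Lagrange
multipliers derived from approximate Morse index information.  If every subspace on which
`Φ''(u_n) + λ_n |·|² ` is `ζ_n`-negative definite has dimension at most 2, while there is a
fixed subspace `Y` of dimension at least 3 on which `Φ''(u_n) + λ |·|²` is uniformly negative
definite, then eventually `λ_n > λ`; in particular, if this holds for every `λ < 0`, then
`liminf λ_n ≥ 0`. -/
theorem stmt_3
    {E H : Type*} [NormedAddCommGroup E] [InnerProductSpace ℝ E] [CompleteSpace E]
    [NormedAddCommGroup H] [InnerProductSpace ℝ H] [CompleteSpace H]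
    (ι : E →L[ℝ] H) (hιinj : Function.Injective ι)
    (Φ : E → ℝ) (hΦ : ContDiff ℝ 2 Φ)
    (μ : ℝ) (hμ : 0 < μ)
    (u : ℕ → E) (hu : ∀ n, ‖ι (u n)‖ ^ 2 = μ)
    (lamn : ℕ → ℝ)
    (ζ : ℕ → ℝ) (hζpos : ∀ n, 0 < ζ n) (hζ : Tendsto ζ atTop (nhds 0))
    (h1 : ∀ᶠ n in atTop, ∀ W : Submodule ℝ E,
      (∀ φ ∈ W, φ ≠ 0 →
        fderiv ℝ (fderiv ℝ Φ) (u n) φ φ + lamn n * ‖ι φ‖ ^ 2 < -(ζ n) * ‖φ‖ ^ 2) →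
      Module.rank ℝ W ≤ 2) :
    (∀ (lam a : ℝ) (Y : Submodule ℝ E), 0 < a → 3 ≤ Module.rank ℝ Y →
      (∀ᶠ n in atTop, ∀ φ ∈ Y,
        fderiv ℝ (fderiv ℝ Φ) (u n) φ φ + lam * ‖ι φ‖ ^ 2 ≤ -a * ‖φ‖ ^ 2) →
      ∀ᶠ n in atTop, lam < lamn n) ∧
    ((∀ lam : ℝ, lam < 0 → ∃ (a : ℝ) (Y : Submodule ℝ E), 0 < a ∧ 3 ≤ Module.rank ℝ Y ∧
      (∀ᶠ n in atTop, ∀ φ ∈ Y,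
        fderiv ℝ (fderiv ℝ Φ) (u n) φ φ + lam * ‖ι φ‖ ^ 2 ≤ -a * ‖φ‖ ^ 2)) →
      0 ≤ Filter.liminf lamn atTop) := by
  have key : ∀ (lam a : ℝ) (Y : Submodule ℝ E), 0 < a → 3 ≤ Module.rank ℝ Y →
      (∀ᶠ n in atTop, ∀ φ ∈ Y,
        fderiv ℝ (fderiv ℝ Φ) (u n) φ φ + lam * ‖ι φ‖ ^ 2 ≤ -a * ‖φ‖ ^ 2) →
      ∀ᶠ n in atTop, lam < lamn n := by
    intro lam a Y ha hY h2
    filter_upwards [h1, h2, hζ.eventually (gt_mem_nhds ha)] with n hn1 hn2 hn3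
    by_contra! hle
    have hr : Module.rank ℝ Y ≤ 2 := by
      apply hn1 Y
      intro φ hφ hne
      have h := hn2 φ hφ
      have hp : 0 < ‖φ‖ ^ 2 := by positivity
      have h4 : lamn n * ‖ι φ‖ ^ 2 ≤ lam * ‖ι φ‖ ^ 2 := by gcongr
      have h5 : ζ n * ‖φ‖ ^ 2 < a * ‖φ‖ ^ 2 := by gcongr
      linarith
    have h32 := hY.trans hr
    exact absurd h32 (by norm_num)
  refine ⟨key, fun h => ?_⟩
  have hmem : ∀ lam : ℝ, lam < 0 → ∀ᶠ n in atTop, lam ≤ lamn n := by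
    intro lam hlam
    obtain ⟨a, Y, ha, hY, h2⟩ := h lam hlam
    exact (key lam a Y ha hY h2).mono fun n hn => hn.le
  rw [Filter.liminf_eq]
  by_cases hb : BddAbove {a : ℝ | ∀ᶠ n in atTop, a ≤ lamn n}
  · refine le_of_forall_lt fun c hc => ?_
    exact lt_of_lt_of_le (by linarith : c < c / 2) (le_csSup hb (hmem (c / 2) (by linarith)))
  · rw [Real.sSup_of_not_bddAbove hb]
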